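/- Maximal correlation is lower semi-continuous: if 𝒰 and 𝒱 are finite sets and ν_n is a sequence of probability distributions on 𝒰×𝒱 converging (in total variation, equivalently pointwise) to a distribution ν, then liminf_{n→∞} ρ(𝒰,𝒱;ν_n) ≥ ρ(𝒰,𝒱;ν). -/

import Mathlib

open Finset MeasureTheory ProbabilityTheory Filter
open scoped Classical

noncomputable section

namespace NIS

/-- Expectation of `f` under the weight function `p` on a finite type. -/
def pmean {Ω : Type*} [Fintype Ω] (p : Ω → ℝ) (f : Ω → ℝ) : ℝ := ∑ ω, p ω * f ω

/-- Variance of `f` under the weight function `p` on a finite type. -/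
def pvar {Ω : Type*} [Fintype Ω] (p : Ω → ℝ) (f : Ω → ℝ) : ℝ :=
  pmean p (fun ω => (f ω - pmean p f) ^ 2)

/-- `p` is a probability distribution on the finite type `Ω`. -/
def IsDist {Ω : Type*} [Fintype Ω] (p : Ω → ℝ) : Prop :=
  (∀ ω, 0 ≤ p ω) ∧ ∑ ω, p ω = 1

/-- Probability of the event `E` under the weight function `p`. -/
def pprob {Ω : Type*} [Fintype Ω] (p : Ω → ℝ) (E : Ω → Prop) : ℝ :=
  ∑ ω, if E ω then p ω else 0

/-- Total variation distance between two distributions on a finite type. -/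
def tvDist {Ω : Type*} [Fintype Ω] (p q : Ω → ℝ) : ℝ := (1 / 2) * ∑ ω, |p ω - q ω|

/-- Marginal on the first coordinate of a joint distribution. -/
def marginalA {A B : Type*} [Fintype A] [Fintype B] (μ : A × B → ℝ) : A → ℝ :=
  fun a => ∑ b, μ (a, b)

/-- Marginal on the second coordinate of a joint distribution. -/
def marginalB {A B : Type*} [Fintype A] [Fintype B] (μ : A × B → ℝ) : B → ℝ :=
  fun b => ∑ a, μ (a, b)

/-- The Hirschfeld–Gebelein–Rényi maximal correlation of a finite joint distribution. -/
def maxCorr {A B : Type*} [Fintype A] [Fintype B] (μ : A × B → ℝ) : ℝ :=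
  sSup { r | ∃ f : A → ℝ, ∃ g : B → ℝ,
    pmean (marginalA μ) f = 0 ∧ pmean (marginalB μ) g = 0 ∧
    pvar (marginalA μ) f = 1 ∧ pvar (marginalB μ) g = 1 ∧
    pmean μ (fun ab => f ab.1 * g ab.2) = r }

/-- `n`-fold product distribution of a distribution `μA` on `A`. -/
def prodDist {A : Type*} [Fintype A] (μA : A → ℝ) (n : ℕ) : (Fin n → A) → ℝ :=
  fun x => ∏ i, μA (x i)

/-- `n`-fold product of a joint distribution `μ` on `A × B`, identified with a distribution on
`A^n × B^n`. -/
def prodPair {A B : Type*} [Fintype A] [Fintype B] (μ : A × B → ℝ) (n : ℕ) :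
    (Fin n → A) × (Fin n → B) → ℝ :=
  fun p => ∏ i, μ (p.1 i, p.2 i)

/-- The influence of coordinate `i` on `f : A^n → ℝ` with respect to `μA^{⊗n}`:
`Inf_i(f) = E_{x_{-i}}[Var_{x_i} f] = ½ E_{x, a}[(f(x) - f(x_i ← a))²]`. -/
def influence {A : Type*} [Fintype A] {n : ℕ} (μA : A → ℝ) (i : Fin n)
    (f : (Fin n → A) → ℝ) : ℝ :=
  (1 / 2) * ∑ x : Fin n → A, ∑ a : A,
    (∏ j, μA (x j)) * μA a * (f x - f (Function.update x i a)) ^ 2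

/-- Total influence of `f`. -/
def totalInfluence {A : Type*} [Fintype A] {n : ℕ} (μA : A → ℝ)
    (f : (Fin n → A) → ℝ) : ℝ :=
  ∑ i, influence μA i f

/-- `g` depends on at most `d` coordinates. -/
def DependsOnLE {A : Type*} {n : ℕ} (d : ℕ) (g : (Fin n → A) → ℝ) : Prop :=
  ∃ J : Finset (Fin n), J.card ≤ d ∧
    ∀ x y : Fin n → A, (∀ i ∈ J, x i = y i) → g x = g y

/-- `f` has degree at most `d`: it lies in the linear span of functions each depending on at
most `d` coordinates. -/
def degLE {A : Type*} {n : ℕ} (d : ℕ) (f : (Fin n → A) → ℝ) : Prop :=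
  f ∈ Submodule.span ℝ { g : (Fin n → A) → ℝ | DependsOnLE d g }

/-- Restriction of `P` fixing the coordinates in `H` to the values of `ξ`; the result only
depends on the coordinates outside `H`. -/
def restrictFn {A : Type*} {n : ℕ} (H : Finset (Fin n)) (ξ : Fin n → A)
    (P : (Fin n → A) → ℝ) : (Fin n → A) → ℝ :=
  fun x => P (fun i => if i ∈ H then ξ i else x i)

/-- The 2-dimensional Gaussian distribution `G(ρ)` with standard normal marginals and
correlation `ρ`. -/
def gauss2 (ρ : ℝ) : Measure (ℝ × ℝ) :=
  Measure.map (fun p : ℝ × ℝ => (p.1, ρ * p.1 + Real.sqrt (1 - ρ ^ 2) * p.2))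
    ((gaussianReal 0 1).prod (gaussianReal 0 1))

/-- The standard normal cumulative distribution function `Φ`. -/
def stdNormalCDF (t : ℝ) : ℝ := ((gaussianReal 0 1) (Set.Iic t)).toReal

/-- The inverse `Φ⁻¹` of the standard normal CDF (junk values outside `(0,1)`). -/
def stdNormalCDFInv : ℝ → ℝ := Function.invFun stdNormalCDF

/-- The ±1-valued threshold function: `thr t r = 1` if `r ≥ t`, and `-1` otherwise. -/
def thr (t r : ℝ) : ℝ := if t ≤ r then 1 else -1

/-- The Gaussian stability quantity `Γ̄_ρ(m, v)`. -/
def Gammabar (ρ m v : ℝ) : ℝ :=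
  ∫ q : ℝ × ℝ, (if q.1 ≤ stdNormalCDFInv ((1 + m) / 2) then (1 : ℝ) else -1) *
    (if q.2 ≤ stdNormalCDFInv ((1 + v) / 2) then (1 : ℝ) else -1) ∂(gauss2 ρ)

/-- Pushforward of `μ^{⊗n}` under the pair of maps `(f, g)`. -/
def push {A B U V : Type*} [Fintype A] [Fintype B] (μ : A × B → ℝ) (n : ℕ)
    (f : (Fin n → A) → U) (g : (Fin n → B) → V) : U × V → ℝ :=
  fun uv => ∑ z : Fin n → A × B,
    if f (fun i => (z i).1) = uv.1 ∧ g (fun i => (z i).2) = uv.2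
    then ∏ i, μ (z i) else 0

/-- `ν` can be non-interactively simulated from `μ`. -/
def CanSimulate {A B U V : Type*} [Fintype A] [Fintype B] [Fintype U] [Fintype V]
    (μ : A × B → ℝ) (ν : U × V → ℝ) : Prop :=
  ∃ f : (n : ℕ) → (Fin n → A) → U, ∃ g : (n : ℕ) → (Fin n → B) → V,
    Tendsto (fun n => tvDist (push μ n (f n) (g n)) ν) atTop (nhds 0)

/-- The doubly symmetric binary source `DSBS(ρ)`, as a distribution on `Bool × Bool`, where
`true` encodes `+1` and `false` encodes `-1`. -/
def DSBS (ρ : ℝ) : Bool × Bool → ℝ :=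
  fun bv => if bv.1 = bv.2 then (1 + ρ) / 4 else (1 - ρ) / 4

/-- The ±1 value encoded by a Boolean. -/
def sgn (b : Bool) : ℝ := if b then 1 else -1

/-- Minimum nonzero probability of an atom. -/
def minAtom {A : Type*} [Fintype A] (μA : A → ℝ) : ℝ :=
  sInf { x | ∃ a, μA a = x ∧ 0 < x }

/-- The hypercontractivity constant `C₄(α)`. -/
def C4 (α : ℝ) : ℝ :=
  if α = 1 / 2 then 3 else
    (((1 - α) / α) ^ ((3 : ℝ) / 4) - ((1 - α) / α) ^ (-((3 : ℝ) / 4))) /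
    (((1 - α) / α) ^ ((1 : ℝ) / 4) - ((1 - α) / α) ^ (-((1 : ℝ) / 4)))

theorem pmean_marginalA {A B : Type*} [Fintype A] [Fintype B] (μ : A × B → ℝ) (f : A → ℝ) :
    pmean (marginalA μ) f = pmean μ (fun ab => f ab.1) := by
  simp only [pmean, marginalA, Fintype.sum_prod_type, Finset.sum_mul]

theorem pmean_marginalB {A B : Type*} [Fintype A] [Fintype B] (μ : A × B → ℝ) (g : B → ℝ) :
    pmean (marginalB μ) g = pmean μ (fun ab => g ab.2) := by
  simp only [pmean, marginalB, Fintype.sum_prod_type_right, Finset.sum_mul]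

theorem IsDist.marginalA {A B : Type*} [Fintype A] [Fintype B] {μ : A × B → ℝ}
    (h : IsDist μ) : IsDist (marginalA μ) :=
  ⟨fun _ => Finset.sum_nonneg fun _ _ => h.1 _, by
    simpa only [NIS.marginalA, Fintype.sum_prod_type] using h.2⟩

theorem IsDist.marginalB {A B : Type*} [Fintype A] [Fintype B] {μ : A × B → ℝ}
    (h : IsDist μ) : IsDist (marginalB μ) :=
  ⟨fun _ => Finset.sum_nonneg fun _ _ => h.1 _, by
    simpa only [NIS.marginalB, Fintype.sum_prod_type_right] using h.2⟩

theorem pmean_div_const {Ω : Type*} [Fintype Ω] (p f : Ω → ℝ) (c : ℝ) :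
    pmean p (fun ω => f ω / c) = pmean p f / c := by
  simp only [pmean, Finset.sum_div, mul_div_assoc]

theorem IsDist.pmean_sub_pmean {Ω : Type*} [Fintype Ω] {p : Ω → ℝ} (hp : IsDist p)
    (f : Ω → ℝ) : pmean p (fun ω => f ω - pmean p f) = 0 := by
  have : pmean p (fun ω => f ω - pmean p f) = pmean p f - (∑ ω, p ω) * pmean p f := by
    rw [Finset.sum_mul]
    simp only [pmean, mul_sub, Finset.sum_sub_distrib]
  rw [this, hp.2, one_mul, sub_self]

theorem pvar_of_pmean_eq_zero {Ω : Type*} [Fintype Ω] {p f : Ω → ℝ} (h : pmean p f = 0) :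
    pvar p f = pmean p (fun ω => f ω ^ 2) := by
  simp only [pvar, h, sub_zero]

/-- The standardization of `f` under `p`. -/
def standardize {Ω : Type*} [Fintype Ω] (p f : Ω → ℝ) : Ω → ℝ :=
  fun ω => (f ω - pmean p f) / √(pvar p f)

theorem pmean_standardize {Ω : Type*} [Fintype Ω] {p : Ω → ℝ} (hp : IsDist p) (f : Ω → ℝ) :
    pmean p (standardize p f) = 0 := by
  unfold standardize
  rw [pmean_div_const, hp.pmean_sub_pmean, zero_div]

theorem pvar_standardize {Ω : Type*} [Fintype Ω] {p : Ω → ℝ} (hp : IsDist p) {f : Ω → ℝ}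
    (hf : 0 < pvar p f) : pvar p (standardize p f) = 1 := by
  rw [pvar_of_pmean_eq_zero (pmean_standardize hp f)]
  simp only [standardize, div_pow, Real.sq_sqrt hf.le, pmean_div_const]
  exact div_self hf.ne'

/-- The set of correlations of standardized pairs of functions, whose supremum is `maxCorr`. -/
def corrSet {A B : Type*} [Fintype A] [Fintype B] (μ : A × B → ℝ) : Set ℝ :=
  { r | ∃ f : A → ℝ, ∃ g : B → ℝ,
    pmean (marginalA μ) f = 0 ∧ pmean (marginalB μ) g = 0 ∧
    pvar (marginalA μ) f = 1 ∧ pvar (marginalB μ) g = 1 ∧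
    pmean μ (fun ab => f ab.1 * g ab.2) = r }

theorem IsDist.le_one_of_mem_corrSet {A B : Type*} [Fintype A] [Fintype B] {μ : A × B → ℝ}
    (hμ : IsDist μ) {r : ℝ} (hr : r ∈ corrSet μ) : r ≤ 1 := by
  obtain ⟨f, g, hf, hg, hf', hg', rfl⟩ := hr
  rw [pvar_of_pmean_eq_zero hf, pmean_marginalA] at hf'
  rw [pvar_of_pmean_eq_zero hg, pmean_marginalB] at hg'
  have key : 2 * pmean μ (fun ab => f ab.1 * g ab.2) ≤
      pmean μ (fun ab => f ab.1 ^ 2) + pmean μ (fun ab => g ab.2 ^ 2) := by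
    simp only [pmean, Finset.mul_sum, ← Finset.sum_add_distrib]
    refine Finset.sum_le_sum fun ω _ => ?_
    nlinarith [mul_nonneg (hμ.1 ω) (sq_nonneg (f ω.1 - g ω.2))]
  linarith

theorem IsDist.bddAbove_corrSet {A B : Type*} [Fintype A] [Fintype B] {μ : A × B → ℝ}
    (hμ : IsDist μ) : BddAbove (corrSet μ) :=
  ⟨1, fun _ => hμ.le_one_of_mem_corrSet⟩

theorem IsDist.maxCorr_le_one {A B : Type*} [Fintype A] [Fintype B] {μ : A × B → ℝ}
    (hμ : IsDist μ) : maxCorr μ ≤ 1 :=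
  Real.sSup_le (fun _ => hμ.le_one_of_mem_corrSet) zero_le_one

theorem neg_mem_corrSet {A B : Type*} [Fintype A] [Fintype B] {μ : A × B → ℝ} {r : ℝ}
    (hr : r ∈ corrSet μ) : -r ∈ corrSet μ := by
  obtain ⟨f, g, hf, hg, hf', hg', rfl⟩ := hr
  have hneg : pmean (marginalA μ) (fun a => -f a) = 0 := by
    simpa [pmean] using hf
  refine ⟨fun a => -f a, g, hneg, hg, ?_, hg', by simp [pmean]⟩
  rw [pvar_of_pmean_eq_zero hneg]
  simpa only [neg_sq, pvar_of_pmean_eq_zero hf] using hf'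

theorem IsDist.maxCorr_nonneg {A B : Type*} [Fintype A] [Fintype B] {μ : A × B → ℝ}
    (hμ : IsDist μ) : 0 ≤ maxCorr μ := by
  change 0 ≤ sSup (corrSet μ)
  rcases (corrSet μ).eq_empty_or_nonempty with h | ⟨r, hr⟩
  · rw [h, Real.sSup_empty]
  · have h₁ := le_csSup hμ.bddAbove_corrSet hr
    have h₂ := le_csSup hμ.bddAbove_corrSet (neg_mem_corrSet hr)
    linarith

theorem IsDist.pmean_standardize_mul_le_maxCorr {A B : Type*} [Fintype A] [Fintype B]
    {μ : A × B → ℝ} (hμ : IsDist μ) {f : A → ℝ} {g : B → ℝ}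
    (hf : 0 < pvar (NIS.marginalA μ) f) (hg : 0 < pvar (NIS.marginalB μ) g) :
    pmean μ (fun ab =>
      standardize (NIS.marginalA μ) f ab.1 * standardize (NIS.marginalB μ) g ab.2)
      ≤ maxCorr μ :=
  le_csSup hμ.bddAbove_corrSet
    ⟨_, _, pmean_standardize hμ.marginalA f, pmean_standardize hμ.marginalB g,
      pvar_standardize hμ.marginalA hf, pvar_standardize hμ.marginalB hg, rfl⟩

theorem tendsto_apply_of_tendsto_tvDist {ι Ω : Type*} [Fintype Ω] {l : Filter ι}
    {p : ι → Ω → ℝ} {q : Ω → ℝ} (h : Tendsto (fun n => tvDist (p n) q) l (nhds 0)) (ω : Ω) :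
    Tendsto (fun n => p n ω) l (nhds (q ω)) := by
  rw [tendsto_iff_dist_tendsto_zero]
  refine squeeze_zero (fun _ => dist_nonneg) (fun n => ?_) (by simpa using h.const_mul 2)
  have : |p n ω - q ω| ≤ ∑ ω, |p n ω - q ω| :=
    Finset.single_le_sum (f := fun ω => |p n ω - q ω|) (fun _ _ => abs_nonneg _)
      (Finset.mem_univ ω)
  rw [Real.dist_eq, tvDist]
  linarith

theorem tendsto_pmean {ι Ω : Type*} [Fintype Ω] {l : Filter ι} {p f : ι → Ω → ℝ}
    {q g : Ω → ℝ} (hp : ∀ ω, Tendsto (fun n => p n ω) l (nhds (q ω)))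
    (hf : ∀ ω, Tendsto (fun n => f n ω) l (nhds (g ω))) :
    Tendsto (fun n => pmean (p n) (f n)) l (nhds (pmean q g)) :=
  tendsto_finsetSum _ fun ω _ => (hp ω).mul (hf ω)

theorem tendsto_pvar {ι Ω : Type*} [Fintype Ω] {l : Filter ι} {p : ι → Ω → ℝ}
    {q : Ω → ℝ} (hp : ∀ ω, Tendsto (fun n => p n ω) l (nhds (q ω))) (f : Ω → ℝ) :
    Tendsto (fun n => pvar (p n) f) l (nhds (pvar q f)) := by
  have hm : Tendsto (fun n => pmean (p n) f) l (nhds (pmean q f)) :=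
    tendsto_pmean hp fun _ => tendsto_const_nhds
  exact tendsto_pmean hp fun ω => (hm.const_sub (f ω)).pow 2

theorem tendsto_standardize {ι Ω : Type*} [Fintype Ω] {l : Filter ι} {p : ι → Ω → ℝ}
    {q f : Ω → ℝ} (hp : ∀ ω, Tendsto (fun n => p n ω) l (nhds (q ω)))
    (h₀ : pmean q f = 0) (h₁ : pvar q f = 1) (ω : Ω) :
    Tendsto (fun n => standardize (p n) f ω) l (nhds (f ω)) := by
  have hm : Tendsto (fun n => pmean (p n) f) l (nhds (pmean q f)) :=
    tendsto_pmean hp fun _ => tendsto_const_nhds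
  have hs := (tendsto_pvar hp f).sqrt
  have h : Tendsto (fun n => standardize (p n) f ω) l
      (nhds ((f ω - pmean q f) / √(pvar q f))) :=
    (hm.const_sub (f ω)).div hs (by simp [h₁])
  simpa [h₀, h₁] using h

/-- Lower semi-continuity of maximal correlation: if `ν n → ν` in total
variation, then `liminf_n ρ(𝒰,𝒱;ν n) ≥ ρ(𝒰,𝒱;ν)`. -/
theorem stmt18 {U V : Type*} [Fintype U] [Fintype V] (ν : ℕ → U × V → ℝ)
    (νlim : U × V → ℝ) (hν : ∀ n, IsDist (ν n)) (hlim : IsDist νlim)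
    (hconv : Tendsto (fun n => tvDist (ν n) νlim) atTop (nhds 0)) :
    maxCorr νlim ≤ Filter.liminf (fun n => maxCorr (ν n)) atTop := by
  have hcobdd : IsCoboundedUnder (· ≥ ·) atTop fun n => maxCorr (ν n) :=
    (isBoundedUnder_of ⟨1, fun n => (hν n).maxCorr_le_one⟩ :
      IsBoundedUnder (· ≤ ·) atTop fun n => maxCorr (ν n)).isCoboundedUnder_ge
  refine Real.sSup_le ?_
    (le_liminf_of_le hcobdd (Eventually.of_forall fun n => (hν n).maxCorr_nonneg))
  rintro r ⟨f, g, hf, hg, hf', hg', rfl⟩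
  have hp := tendsto_apply_of_tendsto_tvDist hconv
  have hpA : ∀ a, Tendsto (fun n => marginalA (ν n) a) atTop (nhds (marginalA νlim a)) :=
    fun a => tendsto_finsetSum _ fun b _ => hp (a, b)
  have hpB : ∀ b, Tendsto (fun n => marginalB (ν n) b) atTop (nhds (marginalB νlim b)) :=
    fun b => tendsto_finsetSum _ fun a _ => hp (a, b)
  have hcorr := tendsto_pmean hp fun ab : U × V =>
    (tendsto_standardize hpA hf hf' ab.1).mul (tendsto_standardize hpB hg hg' ab.2)
  have hposA := (tendsto_pvar hpA f).eventually_const_lt (hf' ▸ zero_lt_one)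
  have hposB := (tendsto_pvar hpB g).eventually_const_lt (hg' ▸ zero_lt_one)
  rw [← hcorr.liminf_eq]
  refine liminf_le_liminf ?_ hcorr.isBoundedUnder_ge hcobdd
  filter_upwards [hposA, hposB] with n hA hB
  exact (hν n).pmean_standardize_mul_le_maxCorr hA hB

end NIS
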